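/- Let ρ ∈ (−1,1) and let F : (0,∞) → (0,∞) be a function satisfying ∫_{S₀}^{F(x)} dy/(y η(y)) = ρ ∫_{V₀}^{x} dy/(√y σ(y)) for every x > 0. Then I_ρ(S₀,V₀,K) ≤ inf { (1/2) ∫₀¹ ( h'(t)/σ(e^{h(t)}) )² dt : h : [0,1] → ℝ absolutely continuous with square-integrable derivative, h(0) = log V₀, ∫₀¹ e^{h(t)} η²(F(e^{h(t)})) dt = K }. -/

import Mathlib

open MeasureTheory

/-- `f : [0,1] → ℝ` is absolutely continuous with square-integrable derivative `f'`. -/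
def AC (f f' : ℝ → ℝ) : Prop :=
  IntervalIntegrable f' MeasureTheory.volume 0 1 ∧
  IntervalIntegrable (fun t => (f' t) ^ 2) MeasureTheory.volume 0 1 ∧
  ∀ t ∈ Set.Icc (0 : ℝ) 1, f t = f 0 + ∫ s in (0 : ℝ)..t, f' s

/-- The functional `Λ_ρ[g,h]` (with chosen derivatives `g'`, `h'`). -/
noncomputable def Lam (η σ : ℝ → ℝ) (ρ : ℝ) (g g' h h' : ℝ → ℝ) : ℝ :=
  (1 / (2 * (1 - ρ ^ 2))) *
    (∫ t in (0 : ℝ)..1,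
      (g' t / (η (Real.exp (g t)) * Real.sqrt (Real.exp (h t))) -
        ρ * h' t / σ (Real.exp (h t))) ^ 2) +
  (1 / 2) * (∫ t in (0 : ℝ)..1, (h' t / σ (Real.exp (h t))) ^ 2)

/-- Admissible values of the variational problem defining the rate function. -/
def RateValues (η σ : ℝ → ℝ) (ρ S₀ V₀ K : ℝ) : Set ℝ :=
  {y | ∃ g g' h h' : ℝ → ℝ, AC g g' ∧ AC h h' ∧
    g 0 = Real.log S₀ ∧ h 0 = Real.log V₀ ∧
    (∫ t in (0 : ℝ)..1, Real.exp (h t) * (η (Real.exp (g t))) ^ 2) = K ∧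
    y = Lam η σ ρ g g' h h'}

/-- The rate function `I_ρ(S₀,V₀,K)`. -/
noncomputable def RateI (η σ : ℝ → ℝ) (ρ S₀ V₀ K : ℝ) : ℝ :=
  sInf (RateValues η σ ρ S₀ V₀ K)

open Set Filter Topology

theorem LipschitzOnWith.comp_absolutelyContinuousOnInterval {φ f : ℝ → ℝ} {C : NNReal} {s : Set ℝ}
    {a b : ℝ} (hφ : LipschitzOnWith C φ s) (hf : AbsolutelyContinuousOnInterval f a b)
    (hs : MapsTo f (uIcc a b) s) : AbsolutelyContinuousOnInterval (fun t => φ (f t)) a b := by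
  rw [absolutelyContinuousOnInterval_iff] at hf ⊢
  intro ε hε
  obtain ⟨δ, hδ, h⟩ := hf (ε / (C + 1)) (by positivity)
  refine ⟨δ, hδ, fun E hE hEδ => ?_⟩
  have h1 := h E hE hEδ
  calc ∑ i ∈ Finset.range E.1, dist (φ (f (E.2 i).1)) (φ (f (E.2 i).2))
      ≤ ∑ i ∈ Finset.range E.1, C * dist (f (E.2 i).1) (f (E.2 i).2) := by
        refine Finset.sum_le_sum fun i hi => ?_
        exact hφ.dist_le_mul _ (hs (hE.1 i hi).1) _ (hs (hE.1 i hi).2)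
    _ = C * ∑ i ∈ Finset.range E.1, dist (f (E.2 i).1) (f (E.2 i).2) := by
        rw [Finset.mul_sum]
    _ ≤ C * (ε / (C + 1)) := by gcongr
    _ < (C + 1) * (ε / (C + 1)) := by gcongr; linarith
    _ = ε := by field_simp

theorem AC.continuousOn {f f' : ℝ → ℝ} (hf : AC f f') : ContinuousOn f (Icc 0 1) := by
  obtain ⟨h1, -, h3⟩ := hf
  have := (h1.absolutelyContinuousOnInterval_intervalIntegral (c := 0) (by simp)).continuousOn
  rw [uIcc_of_le zero_le_one] at this
  exact (continuousOn_const.add this).congr h3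

theorem AC.comp {f f' φ φ' : ℝ → ℝ} (hf : AC f f') (hφ : ∀ x, HasDerivAt φ (φ' x) x)
    (hφ' : Continuous φ') : AC (fun t => φ (f t)) (fun t => φ' (f t) * f' t) := by
  have hfc := hf.continuousOn
  obtain ⟨h1, h2, h3⟩ := hf
  have huIcc : uIcc (0 : ℝ) 1 = Icc 0 1 := uIcc_of_le zero_le_one
  have hcont : ContinuousOn (fun t => φ' (f t)) (uIcc 0 1) := by
    rw [huIcc]; exact hφ'.comp_continuousOn hfc
  refine ⟨h1.continuousOn_mul hcont, ?_, fun t ht => ?_⟩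
  · simpa only [mul_pow, Pi.pow_apply] using h2.continuousOn_mul (hcont.pow 2)
  have h1t : IntervalIntegrable f' volume 0 t :=
    h1.mono_set (by rw [huIcc, uIcc_of_le ht.1]; exact Icc_subset_Icc_right ht.2)
  set H : ℝ → ℝ := fun t => f 0 + ∫ s in (0 : ℝ)..t, f' s with hH
  have hHf : ∀ x ∈ Icc (0 : ℝ) 1, H x = f x := fun x hx => (h3 x hx).symm
  have hHac : AbsolutelyContinuousOnInterval H 0 t :=
    (contDiffOn_const (c := f 0)).absolutelyContinuousOnInterval.fun_add
      (h1t.absolutelyContinuousOnInterval_intervalIntegral (c := 0) (by simp))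
  obtain ⟨R, hR⟩ := hHac.exists_bound
  have hφ1 : ContDiff ℝ 1 φ := by
    rw [contDiff_one_iff_deriv]
    refine ⟨fun x => (hφ x).differentiableAt, ?_⟩
    rwa [show deriv φ = φ' from funext fun x => (hφ x).deriv]
  obtain ⟨C, hC⟩ := hφ1.contDiffOn.exists_lipschitzOnWith (s := Icc (-R) R) (by decide)
    (convex_Icc _ _) isCompact_Icc
  have hcomp := hC.comp_absolutelyContinuousOnInterval hHac
    (fun x hx => abs_le.1 (hR x hx))
  have hint := hcomp.integral_deriv_eq_sub
  have hcongr : ∫ x in (0 : ℝ)..t, deriv (fun t => φ (H t)) x =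
      ∫ x in (0 : ℝ)..t, φ' (f x) * f' x := by
    apply intervalIntegral.integral_congr_ae
    filter_upwards [h1t.ae_hasDerivAt_integral] with x hx hxt
    have hd := (hx (uIoc_subset_uIcc hxt) 0 (by simp)).const_add (f 0)
    have hxI : x ∈ Icc (0 : ℝ) 1 := by
      rw [uIoc_of_le ht.1] at hxt
      exact ⟨hxt.1.le, hxt.2.trans ht.2⟩
    rw [← hHf x hxI]
    exact ((hφ (H x)).comp x hd).deriv
  rw [← hcongr, hint, hHf t ht, hHf 0 (by simp)]
  ring

theorem hasStrictDerivAt_integral_of_continuousOn_Ioi {k : ℝ → ℝ} {c a b : ℝ}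
    (hk : ContinuousOn k (Ioi c)) (ha : c < a) (hb : c < b) :
    HasStrictDerivAt (fun u => ∫ y in a..u, k y) (k b) b := by
  refine intervalIntegral.integral_hasStrictDerivAt_right ?_ ?_
    (hk.continuousAt (Ioi_mem_nhds hb))
  · refine (hk.mono fun y hy => ?_).intervalIntegrable
    exact lt_of_lt_of_le (lt_min ha hb) hy.1
  · exact hk.stronglyMeasurableAtFilter isOpen_Ioi _ hb

/-- A function implicitly defined by `Φ (F x) = Ψ x`, with `Φ` strictly increasing, is
differentiable. -/
theorem hasDerivAt_of_comp_eq {Φ Ψ F : ℝ → ℝ} {x c d : ℝ} (hΦ : StrictMonoOn Φ (Ioi 0))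
    (hF : ∀ x, 0 < x → 0 < F x) (hx : 0 < x) (heq : ∀ x, 0 < x → Φ (F x) = Ψ x)
    (hΦ' : HasStrictDerivAt Φ c (F x)) (hc : c ≠ 0) (hΨ' : HasDerivAt Ψ d x) :
    HasDerivAt F (c⁻¹ * d) x := by
  have hpos : ∀ᶠ y in 𝓝 x, 0 < y := Ioi_mem_nhds hx
  have hFc : ContinuousAt F x := by
    have hlim : Tendsto Ψ (𝓝 x) (𝓝 (Φ (F x))) := by
      rw [heq x hx]; exact hΨ'.continuousAt
    refine tendsto_order.2 ⟨fun a ha => ?_, fun b hb => ?_⟩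
    · have ha' : max a (F x / 2) < F x := max_lt ha (half_lt_self (hF x hx))
      have h0 : 0 < max a (F x / 2) := lt_max_of_lt_right (half_pos (hF x hx))
      filter_upwards [hpos, hlim.eventually_const_lt (hΦ h0 (hF x hx) ha')] with y hy hlt
      rw [← heq y hy, hΦ.lt_iff_lt h0 (hF y hy)] at hlt
      exact (le_max_left _ _).trans_lt hlt
    · have h0 : 0 < b := (hF x hx).trans hb
      filter_upwards [hpos, hlim.eventually_lt_const (hΦ (hF x hx) h0 hb)] with y hy hlt
      rwa [← heq y hy, hΦ.lt_iff_lt (hF y hy) h0] at hlt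
  have hinv := (hΦ'.to_localInverse hc).hasDerivAt
  rw [heq x hx] at hinv
  refine (hinv.comp x hΨ').congr_of_eventuallyEq ?_
  have hleft := (hΦ'.hasStrictFDerivAt_equiv hc).eventually_left_inverse
  filter_upwards [hpos, hFc.eventually hleft] with y hy h
  rw [Function.comp_apply, ← heq y hy]
  exact h.symm

/-- The derivative of `u ↦ log (F (exp u))` is computed from the integral equation for `F`. -/
theorem hasDerivAt_log_comp_exp {η σ F : ℝ → ℝ} {ρ S₀ V₀ : ℝ} (hS₀ : 0 < S₀) (hV₀ : 0 < V₀)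
    (hηc : ContinuousOn η (Ioi 0)) (hσc : ContinuousOn σ (Ioi 0))
    (hη : ∀ x, 0 < x → 0 < η x) (hσ : ∀ x, 0 < x → 0 < σ x)
    (hFpos : ∀ x, 0 < x → 0 < F x)
    (hF : ∀ x, 0 < x →
      (∫ y in S₀..F x, 1 / (y * η y)) = ρ * ∫ y in V₀..x, 1 / (Real.sqrt y * σ y)) :
    F V₀ = S₀ ∧ ∀ u, HasDerivAt (fun u => Real.log (F (Real.exp u)))
      (ρ * η (F (Real.exp u)) * Real.sqrt (Real.exp u) / σ (Real.exp u)) u := by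
  have hk1 : ContinuousOn (fun y => 1 / (y * η y)) (Ioi 0) :=
    continuousOn_const.div (continuousOn_id.mul hηc) fun y hy => (mul_pos hy (hη y hy)).ne'
  have hk2 : ContinuousOn (fun y => 1 / (Real.sqrt y * σ y)) (Ioi 0) :=
    continuousOn_const.div (Real.continuous_sqrt.continuousOn.mul hσc)
      fun y hy => (mul_pos (Real.sqrt_pos.2 hy) (hσ y hy)).ne'
  have hΦ' : ∀ b, 0 < b → HasStrictDerivAt (fun u => ∫ y in S₀..u, 1 / (y * η y))
      (1 / (b * η b)) b :=
    fun b hb => hasStrictDerivAt_integral_of_continuousOn_Ioi hk1 hS₀ hb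
  have hΨ' : ∀ b, 0 < b → HasDerivAt (fun u => ρ * ∫ y in V₀..u, 1 / (Real.sqrt y * σ y))
      (ρ * (1 / (Real.sqrt b * σ b))) b :=
    fun b hb => ((hasStrictDerivAt_integral_of_continuousOn_Ioi hk2 hV₀ hb).hasDerivAt).const_mul ρ
  have hmono : StrictMonoOn (fun u => ∫ y in S₀..u, 1 / (y * η y)) (Ioi 0) := by
    refine strictMonoOn_of_deriv_pos (convex_Ioi 0)
      (fun b hb => (hΦ' b hb).hasDerivAt.continuousAt.continuousWithinAt) fun b hb => ?_
    rw [interior_Ioi] at hb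
    rw [(hΦ' b hb).hasDerivAt.deriv]
    exact one_div_pos.2 (mul_pos hb (hη b hb))
  refine ⟨hmono.injOn (hFpos V₀ hV₀) hS₀ (by rw [hF V₀ hV₀]; simp), fun u => ?_⟩
  have hx := Real.exp_pos u
  have hy := hFpos _ hx
  have hηy := hη _ hy
  have hσx := hσ _ hx
  have hsq := Real.sqrt_pos.2 hx
  have hFd := hasDerivAt_of_comp_eq hmono hFpos hx hF (hΦ' _ hy)
    (one_div_pos.2 (mul_pos hy hηy)).ne' (hΨ' _ hx)
  refine ((hFd.comp u (Real.hasDerivAt_exp u)).log hy.ne').congr_deriv ?_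
  simp only [Function.comp_apply]
  field_simp
  rw [Real.sq_sqrt hx.le]

/-- Linear paths realise every positive value of `∫₀¹ q (h t) dt` when `q` is comparable with
`exp`. -/
theorem exists_integral_linear_eq {q : ℝ → ℝ} {m M v K : ℝ} (hq : Continuous q) (hm : 0 < m)
    (hK : 0 < K) (hlow : ∀ u, m * Real.exp u ≤ q u) (hupp : ∀ u, q u ≤ M * Real.exp u) :
    ∃ a : ℝ, ∫ t in (0 : ℝ)..1, q (v + a * t) = K := by
  have hM : 0 < M := by
    have := (hlow 0).trans (hupp 0)
    rw [Real.exp_zero] at this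
    linarith
  have hcont : Continuous fun a : ℝ => ∫ t in (0 : ℝ)..1, q (v + a * t) := by
    apply intervalIntegral.continuous_parametric_intervalIntegral_of_continuous'
    fun_prop
  have hqi : ∀ a : ℝ, IntervalIntegrable (fun t => q (v + a * t)) volume 0 1 :=
    fun a => Continuous.intervalIntegrable (by fun_prop) _ _
  have hv := Real.exp_pos v
  have hexp : ∀ a : ℝ, a ≠ 0 →
      ∫ t in (0 : ℝ)..1, Real.exp (v + a * t) = Real.exp v * ((Real.exp a - 1) / a) := by
    intro a ha
    simp_rw [Real.exp_add]
    rw [intervalIntegral.integral_const_mul, intervalIntegral.integral_comp_mul_left _ ha,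
      integral_exp]
    simp [div_eq_inv_mul]
  have hsmall : ∃ a : ℝ, ∫ t in (0 : ℝ)..1, q (v + a * t) ≤ K := by
    have hb : 0 < M * Real.exp v / K := by positivity
    refine ⟨-(M * Real.exp v / K), ?_⟩
    calc ∫ t in (0 : ℝ)..1, q (v + -(M * Real.exp v / K) * t)
        ≤ ∫ t in (0 : ℝ)..1, M * Real.exp (v + -(M * Real.exp v / K) * t) :=
          intervalIntegral.integral_mono_on zero_le_one (hqi _)
            (Continuous.intervalIntegrable (by fun_prop) _ _) fun t _ => hupp _
      _ = M * (Real.exp v * ((1 - Real.exp (-(M * Real.exp v / K))) / (M * Real.exp v / K))) := by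
          rw [intervalIntegral.integral_const_mul, hexp _ (neg_ne_zero.2 hb.ne'), div_neg, ← neg_div,
            neg_sub]
      _ ≤ M * (Real.exp v * (1 / (M * Real.exp v / K))) := by
          gcongr
          linarith [Real.exp_pos (-(M * Real.exp v / K))]
      _ = K := by field_simp
  have hlarge : ∃ a : ℝ, K ≤ ∫ t in (0 : ℝ)..1, q (v + a * t) := by
    have hb : 0 < 2 * K / (m * Real.exp v) := by positivity
    refine ⟨2 * K / (m * Real.exp v), ?_⟩
    set a := 2 * K / (m * Real.exp v) with ha
    calc K = m * (Real.exp v * (a / 2)) := by rw [ha]; field_simp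
      _ ≤ m * (Real.exp v * ((Real.exp a - 1) / a)) := by
          have h2 : a / 2 ≤ (Real.exp a - 1) / a := by
            rw [le_div_iff₀ hb]
            nlinarith [Real.quadratic_le_exp_of_nonneg hb.le]
          gcongr
      _ = ∫ t in (0 : ℝ)..1, m * Real.exp (v + a * t) := by
          rw [intervalIntegral.integral_const_mul, hexp _ hb.ne']
      _ ≤ ∫ t in (0 : ℝ)..1, q (v + a * t) :=
          intervalIntegral.integral_mono_on zero_le_one
            (Continuous.intervalIntegrable (by fun_prop) _ _) (hqi _) fun t _ => hlow _
  obtain ⟨a, ha⟩ := hsmall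
  obtain ⟨b, hb⟩ := hlarge
  exact mem_range_of_exists_le_of_exists_ge hcont ⟨a, ha⟩ ⟨b, hb⟩

theorem AC.linear (v a : ℝ) : AC (fun t => v + a * t) (fun _ => a) :=
  ⟨intervalIntegrable_const, intervalIntegrable_const, fun t _ => by simp [mul_comm]⟩

theorem Lam_nonneg (η σ : ℝ → ℝ) {ρ : ℝ} (hρ : ρ ∈ Ioo (-1 : ℝ) 1) (g g' h h' : ℝ → ℝ) :
    0 ≤ Lam η σ ρ g g' h h' := by
  have h1 : 0 < 1 - ρ ^ 2 := by nlinarith [hρ.1, hρ.2]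
  have hsq : ∀ f : ℝ → ℝ, 0 ≤ ∫ t in (0 : ℝ)..1, f t ^ 2 := fun f =>
    intervalIntegral.integral_nonneg zero_le_one fun t _ => sq_nonneg _
  exact add_nonneg (mul_nonneg (by positivity) (hsq _)) (mul_nonneg (by norm_num) (hsq _))

/-- If `F : (0,∞) → (0,∞)` satisfies
`∫_{S₀}^{F(x)} dy/(y η(y)) = ρ ∫_{V₀}^{x} dy/(√y σ(y))` for all `x > 0`, then
`I_ρ(S₀,V₀,K)` is bounded above by the infimum of `(1/2)∫₀¹ (h'/σ(e^h))²` over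
absolutely continuous `h` with `h(0) = log V₀` and `∫₀¹ e^{h} η²(F(e^{h})) dt = K`. -/
theorem rateI_le_constrained_inf
    (S₀ V₀ K : ℝ) (hS₀ : 0 < S₀) (hV₀ : 0 < V₀) (hK : 0 < K)
    (η σ : ℝ → ℝ)
    (hηc : ContinuousOn η (Set.Ioi 0)) (hσc : ContinuousOn σ (Set.Ioi 0))
    (mη Mη mσ Mσ : ℝ) (hmη : 0 < mη) (hmσ : 0 < mσ)
    (hηb : ∀ x ∈ Set.Ioi (0 : ℝ), mη ≤ η x ∧ η x ≤ Mη)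
    (hσb : ∀ x ∈ Set.Ioi (0 : ℝ), mσ ≤ σ x ∧ σ x ≤ Mσ)
    (ρ : ℝ) (hρ : ρ ∈ Set.Ioo (-1 : ℝ) 1)
    (F : ℝ → ℝ) (hFpos : ∀ x, 0 < x → 0 < F x)
    (hF : ∀ x, 0 < x →
      (∫ y in S₀..F x, 1 / (y * η y)) = ρ * ∫ y in V₀..x, 1 / (Real.sqrt y * σ y)) :
    RateI η σ ρ S₀ V₀ K ≤
      sInf {y | ∃ h h' : ℝ → ℝ, AC h h' ∧ h 0 = Real.log V₀ ∧
        (∫ t in (0 : ℝ)..1, Real.exp (h t) * (η (F (Real.exp (h t)))) ^ 2) = K ∧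
        y = (1 / 2) * (∫ t in (0 : ℝ)..1, (h' t / σ (Real.exp (h t))) ^ 2)} := by
  have hη : ∀ x, 0 < x → 0 < η x := fun x hx => hmη.trans_le (hηb x hx).1
  have hσ : ∀ x, 0 < x → 0 < σ x := fun x hx => hmσ.trans_le (hσb x hx).1
  obtain ⟨hFV, hderiv⟩ := hasDerivAt_log_comp_exp hS₀ hV₀ hηc hσc hη hσ hFpos hF
  have hFexp : ∀ u, Real.exp (Real.log (F (Real.exp u))) = F (Real.exp u) :=
    fun u => Real.exp_log (hFpos _ (Real.exp_pos u))
  have hFc : Continuous fun u => F (Real.exp u) := by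
    have hlog : Continuous fun u => Real.log (F (Real.exp u)) :=
      continuous_iff_continuousAt.2 fun u => (hderiv u).continuousAt
    exact (Real.continuous_exp.comp hlog).congr hFexp
  have hηF : Continuous fun u => η (F (Real.exp u)) :=
    hηc.comp_continuous hFc fun u => hFpos _ (Real.exp_pos u)
  have hσe : Continuous fun u => σ (Real.exp u) :=
    hσc.comp_continuous Real.continuous_exp fun u => Real.exp_pos u
  have hderivc : Continuous fun u =>
      ρ * η (F (Real.exp u)) * Real.sqrt (Real.exp u) / σ (Real.exp u) :=
    ((continuous_const.mul hηF).mul (Real.continuous_sqrt.comp Real.continuous_exp)).div hσe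
      fun u => (hσ _ (Real.exp_pos u)).ne'
  refine le_csInf ?_ ?_
  · obtain ⟨a, ha⟩ := exists_integral_linear_eq (v := Real.log V₀) (m := mη ^ 2) (M := Mη ^ 2)
      (Real.continuous_exp.mul (hηF.pow 2)) (by positivity) hK
      (fun u => by
        rw [mul_comm, Pi.mul_apply, Pi.pow_apply]
        gcongr
        exact (hηb _ (hFpos _ (Real.exp_pos u))).1)
      (fun u => by
        rw [mul_comm (Mη ^ 2), Pi.mul_apply, Pi.pow_apply]
        have h1 := (hη _ (hFpos _ (Real.exp_pos u))).le
        gcongr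
        exact (hηb _ (hFpos _ (Real.exp_pos u))).2)
    exact ⟨_, _, _, AC.linear (Real.log V₀) a, by simp, ha, rfl⟩
  · rintro y ⟨h, h', hac, h0, hint, rfl⟩
    refine csInf_le ⟨0, ?_⟩ ⟨_, _, h, h', hac.comp hderiv hderivc, hac, ?_, h0, ?_, ?_⟩
    · rintro z ⟨g, g', k, k', -, -, -, -, -, rfl⟩
      exact Lam_nonneg η σ hρ g g' k k'
    · simp only [h0, Real.exp_log hV₀, hFV]
    · simpa only [hFexp] using hint
    · have hzero : ∀ t, ρ * η (F (Real.exp (h t))) * Real.sqrt (Real.exp (h t)) /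
          σ (Real.exp (h t)) * h' t / (η (F (Real.exp (h t))) * Real.sqrt (Real.exp (h t))) -
          ρ * h' t / σ (Real.exp (h t)) = 0 := by
        intro t
        have h1 := hη _ (hFpos _ (Real.exp_pos (h t)))
        have h2 := hσ _ (Real.exp_pos (h t))
        have h3 := Real.sqrt_pos.2 (Real.exp_pos (h t))
        field_simp
        ring
      simp [Lam, hFexp, hzero]
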